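/- arXiv:2508.21513 — 2 statements merged into one kernel-verified Lean document; each statement's English description precedes it below -/
import Mathlib

section
/- The expectation of the reciprocal under the zero-truncated Poisson distribution vanishes in the large-parameter limit; that is, lim_{λ → ∞} ∑_{h=1}^{∞} (1/h) · λ^h / (h! · (e^λ − 1)) = 0. -/
theorem zero_truncated_poisson_reciprocal_term_le {x : ℝ} (hx : 1 ≤ x) (n : ℕ) :
    (1 / ((n + 1 : ℕ) : ℝ)) * x ^ (n + 1) / (((n + 1).factorial : ℝ) * (Real.exp x - 1)) ≤
      2 / (x * (Real.exp x - 1)) * (x ^ (n + 2) / ((n + 2).factorial : ℝ)) := by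
  have hx0 : 0 < x := by linarith
  have he : 0 < Real.exp x - 1 := by linarith [Real.add_one_le_exp x]
  have hn : (0 : ℝ) ≤ n := n.cast_nonneg
  have hf : (0 : ℝ) < (n + 1).factorial := by exact_mod_cast (n + 1).factorial_pos
  have hrec : 1 / ((n : ℝ) + 1) ≤ 2 / (n + 2) := by
    rw [div_le_div_iff₀ (by linarith) (by linarith)]
    linarith
  have hfac : ((n + 2).factorial : ℝ) = (n + 2) * (n + 1).factorial := by
    rw [Nat.factorial_succ (n + 1)]
    push_cast
    ring
  calc
    _ = 1 / ((n : ℝ) + 1) * (x ^ (n + 1) / ((n + 1).factorial * (Real.exp x - 1))) := by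
      push_cast
      ring
    _ ≤ 2 / ((n : ℝ) + 2) * (x ^ (n + 1) / ((n + 1).factorial * (Real.exp x - 1))) := by
      gcongr
    _ = _ := by
      rw [hfac]
      field_simp
      ring

theorem zero_truncated_poisson_reciprocal_mean_le {x : ℝ} (hx : 1 ≤ x) :
    (∑' h : ℕ+, (1 / ((h : ℕ) : ℝ)) * x ^ (h : ℕ) /
      (((h : ℕ).factorial : ℝ) * (Real.exp x - 1))) ≤ 4 / x := by
  have hx0 : 0 < x := by linarith
  have he : 2 ≤ Real.exp x := by linarith [Real.add_one_le_exp x]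
  have he' : 0 < Real.exp x - 1 := by linarith
  rw [tsum_pnat_eq_tsum_succ (f := fun h : ℕ => (1 / (h : ℝ)) * x ^ h /
    ((h.factorial : ℝ) * (Real.exp x - 1)))]
  refine Real.tsum_le_of_sum_range_le (fun n => by positivity) fun N => ?_
  have hsum : ∑ n ∈ Finset.range N, x ^ (n + 2) / ((n + 2).factorial : ℝ) ≤ Real.exp x := by
    refine le_trans ?_ (Real.sum_le_exp_of_nonneg hx0.le (N + 2))
    rw [Finset.sum_range_succ', Finset.sum_range_succ', add_assoc]
    exact le_add_of_nonneg_right (by positivity)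
  calc
    _ ≤ ∑ n ∈ Finset.range N,
        2 / (x * (Real.exp x - 1)) * (x ^ (n + 2) / ((n + 2).factorial : ℝ)) :=
      Finset.sum_le_sum fun n _ => zero_truncated_poisson_reciprocal_term_le hx n
    _ ≤ 2 / (x * (Real.exp x - 1)) * Real.exp x := by
      rw [← Finset.mul_sum]
      gcongr
    _ ≤ 4 / x := by
      rw [div_mul_eq_mul_div, div_le_div_iff₀ (by positivity) hx0]
      nlinarith

/-- The expectation of the reciprocal `1/h` under the zero-truncated Poisson
distribution with parameter `λ` (which assigns probability
`λ^h / (h! · (e^λ − 1))` to each integer `h ≥ 1`) vanishes as `λ → ∞`. -/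
theorem zero_truncated_poisson_reciprocal_mean_tendsto_zero :
    Filter.Tendsto
      (fun lam : ℝ => ∑' h : ℕ+,
        (1 / ((h : ℕ) : ℝ)) * lam ^ (h : ℕ) /
          (((h : ℕ).factorial : ℝ) * (Real.exp lam - 1)))
      Filter.atTop (nhds 0) := by
  refine squeeze_zero' ?_ ?_ (tendsto_const_nhds.div_atTop Filter.tendsto_id : Filter.Tendsto
    (fun x : ℝ => 4 / x) Filter.atTop (nhds 0))
  · filter_upwards [Filter.eventually_ge_atTop 1] with x hx
    have he : 0 < Real.exp x - 1 := by linarith [Real.add_one_le_exp x]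
    exact tsum_nonneg fun h => by positivity
  · filter_upwards [Filter.eventually_ge_atTop 1] with x hx
    exact zero_truncated_poisson_reciprocal_mean_le hx
end

section
/- Fix an integer k ≥ 2 and define, for an integer M ≥ 2 and h ≥ 1, R̄_{k,M}(h) := 2/h + 2/k − 2 + (h + k − 2)/(max{k − 1, M − 1} · max{h, k}). Then for any sequences λ_n → ∞ of positive reals and M_n → ∞ of integers with M_n ≥ 2, the expectation of R̄_{k,M_n} under the zero-truncated Poisson distribution with parameter λ_n converges to 2/k − 2; that is, lim_{n → ∞} ∑_{h=1}^{∞} R̄_{k,M_n}(h) · λ_n^h / (h! · (e^{λ_n} − 1)) = 2/k − 2. -/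
/-- The zero-truncated Poisson weights sum to one. -/
theorem hasSum_zeroTruncatedPoisson {r : ℝ} (hr : 0 < r) :
    HasSum (fun h : ℕ+ => r ^ (h : ℕ) / (((h : ℕ).factorial : ℝ) * (Real.exp r - 1))) 1 := by
  have hpos : 0 < Real.exp r - 1 := by linarith [Real.add_one_lt_exp hr.ne']
  have hexp : HasSum (fun n : ℕ => r ^ n / (n.factorial : ℝ)) (Real.exp r) := by
    simpa [Real.exp_eq_exp_ℝ] using NormedSpace.expSeries_div_hasSum_exp r
  have hsucc := (hasSum_nat_add_iff' 1).2 hexp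
  have hpnat : HasSum (fun h : ℕ+ => r ^ (h : ℕ) / ((h : ℕ).factorial : ℝ)) (Real.exp r - 1) := by
    rw [← Equiv.pnatEquivNat.symm.hasSum_iff]
    simpa [Function.comp_def] using hsucc
  simpa [div_div, hpos.ne'] using hpnat.div_const (Real.exp r - 1)

/-- The reciprocal of `h + 1` is summable against the zero-truncated Poisson weights of parameter
`r`, with mean at most `1 / r`. -/
theorem exists_hasSum_inv_succ_mul_zeroTruncatedPoisson {r : ℝ} (hr : 0 < r) :
    ∃ s ≤ 1 / r, HasSum (fun h : ℕ+ => 1 / (((h : ℕ) : ℝ) + 1) *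
      (r ^ (h : ℕ) / (((h : ℕ).factorial : ℝ) * (Real.exp r - 1)))) s := by
  have hpos : 0 < Real.exp r - 1 := by linarith [Real.add_one_lt_exp hr.ne']
  have hweights := hasSum_zeroTruncatedPoisson hr
  have hinj : Function.Injective (fun h : ℕ+ => h + 1) := add_left_injective 1
  have hle := tsum_comp_le_tsum_of_inj hweights.summable (fun _ => by positivity) hinj
  rw [hweights.tsum_eq] at hle
  refine ⟨_, mul_le_of_le_one_right (by positivity) hle, ?_⟩
  have hshift := (hweights.summable.comp_injective hinj).hasSum.mul_left (1 / r)
  refine hshift.congr_fun fun h => ?_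
  simp only [Function.comp_apply, PNat.add_coe, PNat.one_coe, Nat.factorial_succ, pow_succ]
  push_cast
  field_simp

/-- If `g` lies between `0` and `a / (h + 1) + b`, then the mean of `c + g` under the zero-truncated
Poisson distribution of parameter `r` lies between `c` and `c + a / r + b`. -/
theorem tsum_zeroTruncatedPoisson_mem_Icc {r a b c : ℝ} (hr : 0 < r) (ha : 0 ≤ a) {g : ℕ+ → ℝ}
    (hg : ∀ h, 0 ≤ g h) (hgle : ∀ h : ℕ+, g h ≤ a * (1 / (((h : ℕ) : ℝ) + 1)) + b) :
    ∑' h : ℕ+, (c + g h) * (r ^ (h : ℕ) / (((h : ℕ).factorial : ℝ) * (Real.exp r - 1))) ∈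
      Set.Icc c (c + (a * (1 / r) + b)) := by
  have hpos : 0 < Real.exp r - 1 := by linarith [Real.add_one_lt_exp hr.ne']
  have hweights := hasSum_zeroTruncatedPoisson hr
  obtain ⟨s, hs, hsum⟩ := exists_hasSum_inv_succ_mul_zeroTruncatedPoisson hr
  set p : ℕ+ → ℝ := fun h => r ^ (h : ℕ) / (((h : ℕ).factorial : ℝ) * (Real.exp r - 1))
  have hp0 : ∀ h, 0 ≤ p h := fun h => by positivity
  have hbound : HasSum (fun h : ℕ+ => (a * (1 / (((h : ℕ) : ℝ) + 1)) + b) * p h) (a * s + b) := by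
    simpa [add_mul, mul_assoc] using (hsum.mul_left a).add (hweights.mul_left b)
  have hterm : ∀ h, g h * p h ≤ (a * (1 / (((h : ℕ) : ℝ) + 1)) + b) * p h := fun h =>
    mul_le_mul_of_nonneg_right (hgle h) (hp0 h)
  have hgp : Summable fun h => g h * p h :=
    hbound.summable.of_nonneg_of_le (fun h => mul_nonneg (hg h) (hp0 h)) hterm
  have htotal : ∑' h, (c + g h) * p h = c + ∑' h, g h * p h := by
    simpa [add_mul] using ((hweights.mul_left c).add hgp.hasSum).tsum_eq
  have hmean_nonneg : 0 ≤ ∑' h, g h * p h := tsum_nonneg fun h => mul_nonneg (hg h) (hp0 h)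
  have hmean_le : ∑' h, g h * p h ≤ a * s + b := hasSum_le hterm hgp.hasSum hbound
  have has : a * s ≤ a * (1 / r) := mul_le_mul_of_nonneg_left hs ha
  rw [htotal]
  constructor <;> linarith

/-- Fix an integer `k ≥ 2` and define, for integers `M ≥ 2` and `h ≥ 1`,
`R̄_{k,M}(h) := 2/h + 2/k − 2 + (h + k − 2)/(max{k − 1, M − 1} · max{h, k})`.
Then for any sequences `λ_n → ∞` of positive reals and `M_n → ∞` of integers
with `M_n ≥ 2`, the expectation of `R̄_{k,M_n}` under the zero-truncated
Poisson distribution with parameter `λ_n` (which assigns probability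
`λ^h / (h! · (e^λ − 1))` to each integer `h ≥ 1`) converges to `2/k − 2`. -/
theorem ztp_mean_upperBound_tendsto_limit (k : ℕ) (hk : 2 ≤ k)
    (lam : ℕ → ℝ) (hlampos : ∀ n, 0 < lam n)
    (hlam : Filter.Tendsto lam Filter.atTop Filter.atTop)
    (M : ℕ → ℕ) (hM : ∀ n, 2 ≤ M n)
    (hMtendsto : Filter.Tendsto M Filter.atTop Filter.atTop) :
    Filter.Tendsto
      (fun n : ℕ => ∑' h : ℕ+,
        (2 / ((h : ℕ) : ℝ) + 2 / (k : ℝ) - 2 +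
            (((h : ℕ) : ℝ) + (k : ℝ) - 2) /
              (max ((k : ℝ) - 1) ((M n : ℝ) - 1) * max ((h : ℕ) : ℝ) (k : ℝ))) *
          lam n ^ (h : ℕ) / (((h : ℕ).factorial : ℝ) * (Real.exp (lam n) - 1)))
      Filter.atTop (nhds (2 / (k : ℝ) - 2)) := by
  have hk' : (2 : ℝ) ≤ k := by exact_mod_cast hk
  have hmem : ∀ n, ∑' h : ℕ+,
        (2 / ((h : ℕ) : ℝ) + 2 / (k : ℝ) - 2 +
            (((h : ℕ) : ℝ) + (k : ℝ) - 2) /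
              (max ((k : ℝ) - 1) ((M n : ℝ) - 1) * max ((h : ℕ) : ℝ) (k : ℝ))) *
          lam n ^ (h : ℕ) / (((h : ℕ).factorial : ℝ) * (Real.exp (lam n) - 1)) ∈
      Set.Icc (2 / (k : ℝ) - 2)
        (2 / (k : ℝ) - 2 + (4 * (1 / lam n) + 2 * (1 / ((M n : ℝ) - 1)))) := by
    intro n
    have hMn : (2 : ℝ) ≤ M n := by exact_mod_cast hM n
    have hD : 0 < max ((k : ℝ) - 1) ((M n : ℝ) - 1) := lt_max_of_lt_left (by linarith)
    have hmean := tsum_zeroTruncatedPoisson_mem_Icc (c := 2 / (k : ℝ) - 2) (a := 4)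
      (b := 2 * (1 / ((M n : ℝ) - 1)))
      (g := fun h : ℕ+ => 2 / ((h : ℕ) : ℝ) + (((h : ℕ) : ℝ) + (k : ℝ) - 2) /
        (max ((k : ℝ) - 1) ((M n : ℝ) - 1) * max ((h : ℕ) : ℝ) (k : ℝ)))
      (hlampos n) (by norm_num) (fun h => ?_) (fun h => ?_)
    · convert hmean using 4 with h
      ring
    · have hh : (1 : ℝ) ≤ (h : ℕ) := by exact_mod_cast h.pos
      have hnum : (0 : ℝ) ≤ (h : ℕ) + (k : ℝ) - 2 := by linarith
      positivity
    · have hh : (1 : ℝ) ≤ (h : ℕ) := by exact_mod_cast h.pos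
      have hmax : 0 < max ((h : ℕ) : ℝ) (k : ℝ) := lt_max_of_lt_left (by linarith)
      refine add_le_add ?_ ?_
      · rw [mul_one_div, div_le_div_iff₀ (by linarith) (by linarith)]
        linarith
      · rw [mul_one_div, div_le_div_iff₀ (mul_pos hD hmax) (by linarith)]
        have hnum : ((h : ℕ) : ℝ) + (k : ℝ) - 2 ≤ 2 * max ((h : ℕ) : ℝ) (k : ℝ) := by
          linarith [le_max_left ((h : ℕ) : ℝ) (k : ℝ), le_max_right ((h : ℕ) : ℝ) (k : ℝ)]
        calc (((h : ℕ) : ℝ) + (k : ℝ) - 2) * ((M n : ℝ) - 1)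
            ≤ 2 * max ((h : ℕ) : ℝ) (k : ℝ) * max ((k : ℝ) - 1) ((M n : ℝ) - 1) :=
              mul_le_mul hnum (le_max_right _ _) (by linarith) (by positivity)
          _ = _ := by ring
  have hlaminv : Filter.Tendsto (fun n => 1 / lam n) Filter.atTop (nhds 0) :=
    hlam.const_div_atTop 1
  have hMinv : Filter.Tendsto (fun n => 1 / ((M n : ℝ) - 1)) Filter.atTop (nhds 0) :=
    (Filter.tendsto_atTop_add_const_right _ (-1)
      (tendsto_natCast_atTop_atTop.comp hMtendsto)).const_div_atTop 1
  have hupper := ((hlaminv.const_mul 4).add (hMinv.const_mul 2)).const_add (2 / (k : ℝ) - 2)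
  simp only [mul_zero, add_zero] at hupper
  exact tendsto_of_tendsto_of_tendsto_of_le_of_le tendsto_const_nhds hupper
    (fun n => (hmem n).1) (fun n => (hmem n).2)
end
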